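/- arXiv:1108.0679 — 2 statements merged into one kernel-verified Lean document; each statement's English description precedes it below -/
import Mathlib

section
/- Let H be an incidence matrix of an S(2,μ,v) with 2 ≤ μ < v. Then the F_2-rank of H satisfies rank(H) ≥ ⌈1/2 + √(1/4 + (v−1)(v−μ)/μ)⌉, and trivially rank(H) ≤ v. -/
open Matrix

/-- Rank factorization. -/
lemma rank_factorization {m n K : Type*} [Fintype m] [Fintype n] [DecidableEq n] [Field K]
    (H : Matrix m n K) :
    ∃ (P : Matrix m (Fin H.rank) K) (Q : Matrix (Fin H.rank) n K), H = P * Q := by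
  let b := Module.finBasis K (LinearMap.range H.mulVecLin)
  let w : n → LinearMap.range H.mulVecLin := fun c =>
    ⟨H.mulVecLin (Pi.single c 1), LinearMap.mem_range_self _ _⟩
  have hw : ∀ c p, (w c).1 p = H p c := by
    intro c p
    simp [w]
  refine ⟨Matrix.of fun p i => (b i).1 p, Matrix.of fun i c => b.repr (w c) i, ?_⟩
  ext p c
  have h2 := congrFun (congrArg Subtype.val (b.sum_repr (w c))) p
  rw [hw] at h2
  rw [← h2, Matrix.mul_apply]
  simp only [Submodule.coe_sum, Finset.sum_apply, Submodule.coe_smul, Pi.smul_apply, smul_eq_mul]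
  refine Finset.sum_congr rfl fun i _ => ?_
  exact mul_comm _ _

lemma finrank_ker_mulVecLin {m n K : Type*} [Fintype m] [Fintype n] [Field K]
    (H : Matrix m n K) :
    H.rank + Module.finrank K (LinearMap.ker H.mulVecLin) = Fintype.card n := by
  have := H.mulVecLin.finrank_range_add_finrank_ker
  rw [Module.finrank_fintype_fun_eq_card] at this
  exact this

lemma z2_add_self (x : ZMod 2) : x + x = 0 := CharTwo.add_self_eq_zero x

/-- Main inequality: the flag matrix has rank at most `R ^ 2`. -/
lemma flag_bound {V W : Type*} [Fintype V] [DecidableEq V] [Fintype W] [DecidableEq W]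
    (I : V → W → Prop) [∀ p C, Decidable (I p C)]
    (hlin : ∀ p q B C, p ≠ q → I p B → I q B → I p C → I q C → B = C)
    (H : Matrix V W (ZMod 2)) (hH : ∀ p C, H p C = if I p C then 1 else 0)
    (hodd : ∀ p, ∑ C, H p C = 1) :
    Fintype.card {x : V × W // I x.1 x.2} + 2 * H.rank
      ≤ H.rank ^ 2 + Fintype.card V + Fintype.card W := by
  classical
  obtain ⟨P, Q, hPQ⟩ := rank_factorization H
  let M : Matrix {x : V × W // I x.1 x.2} {x : V × W // I x.1 x.2} (ZMod 2) := Matrix.of fun x y => H x.1.1 y.1.2 * H y.1.1 x.1.2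
  have hrank : M.rank ≤ H.rank ^ 2 := by
    let A : Matrix {x : V × W // I x.1 x.2} (Fin H.rank × Fin H.rank) (ZMod 2) := Matrix.of fun x ij => P x.1.1 ij.1 * Q ij.2 x.1.2
    let B : Matrix (Fin H.rank × Fin H.rank) {x : V × W // I x.1 x.2} (ZMod 2) := Matrix.of fun ij y => Q ij.1 y.1.2 * P y.1.1 ij.2
    have hM : M = A * B := by
      ext x y
      have e : ∀ p C, H p C = ∑ i, P p i * Q i C := fun p C => by
        conv_lhs => rw [hPQ]
        rw [Matrix.mul_apply]
      rw [Matrix.mul_apply, Fintype.sum_prod_type]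
      simp only [M, e, A, B, Matrix.of_apply, Finset.sum_mul_sum]
      refine Finset.sum_congr rfl fun i _ => Finset.sum_congr rfl fun j _ => ?_
      ring
    rw [hM]
    refine (Matrix.rank_mul_le_left A B).trans ((Matrix.rank_le_card_width A).trans ?_)
    simp [sq]
  -- row and column sums
  let a : ({x : V × W // I x.1 x.2} → ZMod 2) →ₗ[ZMod 2] (V → ZMod 2) :=
    { toFun := fun f p => ∑ y : {x : V × W // I x.1 x.2}, if y.1.1 = p then f y else 0
      map_add' := fun f g => by
        ext p; simp only [Pi.add_apply, ← Finset.sum_add_distrib]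
        exact Finset.sum_congr rfl fun y _ => by split_ifs <;> simp
      map_smul' := fun k f => by
        ext p; simp [Finset.mul_sum] }
  let c : ({x : V × W // I x.1 x.2} → ZMod 2) →ₗ[ZMod 2] (W → ZMod 2) :=
    { toFun := fun f C => ∑ y : {x : V × W // I x.1 x.2}, if y.1.2 = C then f y else 0
      map_add' := fun f g => by
        ext p; simp only [Pi.add_apply, ← Finset.sum_add_distrib]
        exact Finset.sum_congr rfl fun y _ => by split_ifs <;> simp
      map_smul' := fun k f => by
        ext p; simp [Finset.mul_sum] }
  have ha : ∀ f p, a f p = ∑ y : {x : V × W // I x.1 x.2}, if y.1.1 = p then f y else 0 := fun _ _ => rfl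
  have hc : ∀ f C, c f C = ∑ y : {x : V × W // I x.1 x.2}, if y.1.2 = C then f y else 0 := fun _ _ => rfl
  have hMf : ∀ f x, (M *ᵥ f) x = a f x.1.1 + c f x.1.2 + f x := by
    intro f x
    have e : f x = ∑ y : {x : V × W // I x.1 x.2}, if y = x then f y else 0 := by simp
    rw [ha, hc, e, ← Finset.sum_add_distrib, ← Finset.sum_add_distrib]
    refine Finset.sum_congr rfl fun y _ => ?_
    change H x.1.1 y.1.2 * H y.1.1 x.1.2 * f y = _
    obtain ⟨⟨p, C⟩, hx⟩ := x
    obtain ⟨⟨q, B⟩, hy⟩ := y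
    simp only at hx hy
    simp only [hH, Subtype.mk.injEq, Prod.mk.injEq]
    by_cases h1 : q = p
    · subst h1
      by_cases h2 : B = C
      · subst h2
        simp only [hx, if_true, and_self, mul_one, one_mul]
        rw [z2_add_self, zero_add]
      · simp [hx, hy, h2]
    · by_cases h2 : B = C
      · subst h2
        simp [hx, hy, h1]
      · have : ¬ (I p B ∧ I q C) := fun h => h2 (hlin p q B C (Ne.symm h1) h.1 hy hx h.2)
        by_cases h3 : I p B
        · have h4 : ¬ I q C := fun h => this ⟨h3, h⟩
          simp [h1, h2, h4]
        · simp [h1, h2, h3]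
  have hker : ∀ f, M *ᵥ f = 0 → ∀ x, f x = a f x.1.1 + c f x.1.2 := by
    intro f hf x
    have := hMf f x
    rw [hf, Pi.zero_apply] at this
    exact (CharTwo.add_eq_zero.mp this.symm).symm
  -- sums over flags
  have hsum : ∀ g : V × W → ZMod 2, ∑ y : {x : V × W // I x.1 x.2}, g y.1 = ∑ p, ∑ C, H p C * g (p, C) := by
    intro g
    rw [← Fintype.sum_prod_type' (fun p C => H p C * g (p, C))]
    simp only [hH, ite_mul, one_mul, zero_mul]
    rw [← Finset.sum_filter]
    exact (Finset.sum_subtype _ (by simp) g).symm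
  have hHc : ∀ f, M *ᵥ f = 0 → H *ᵥ (c f) = 0 := by
    intro f hf
    ext p
    have h1 : a f p = ∑ y : {x : V × W // I x.1 x.2}, if y.1.1 = p then a f y.1.1 + c f y.1.2 else 0 := by
      rw [ha]
      refine Finset.sum_congr rfl fun y _ => ?_
      rw [← hker f hf y]
    rw [hsum (fun y => if y.1 = p then a f y.1 + c f y.2 else 0)] at h1
    simp only [mul_ite, mul_zero] at h1
    rw [Finset.sum_comm] at h1
    simp only [Finset.sum_ite_eq', Finset.mem_univ, if_true, mul_add, Finset.sum_add_distrib,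
      ← Finset.sum_mul, hodd, one_mul] at h1
    have : (H *ᵥ (c f)) p = ∑ C, H p C * c f C := rfl
    rw [this, Pi.zero_apply]
    exact (left_eq_add.mp h1)
  have hHa : ∀ f, M *ᵥ f = 0 → c f = 0 → Hᵀ *ᵥ (a f) = 0 := by
    intro f hf hcf
    ext C
    have h1 : c f C = ∑ y : {x : V × W // I x.1 x.2}, if y.1.2 = C then a f y.1.1 else 0 := by
      rw [hc]
      refine Finset.sum_congr rfl fun y _ => ?_
      rw [hker f hf y, hcf]; simp
    rw [hsum (fun y => if y.2 = C then a f y.1 else 0)] at h1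
    simp only [mul_ite, mul_zero, Finset.sum_ite_eq', Finset.mem_univ, if_true] at h1
    have : (Hᵀ *ᵥ (a f)) C = ∑ p, H p C * a f p := rfl
    rw [this, ← h1, hcf]
  let φ : LinearMap.ker M.mulVecLin →ₗ[ZMod 2] LinearMap.ker H.mulVecLin :=
    (c.comp (LinearMap.ker M.mulVecLin).subtype).codRestrict _
      (fun f => by simpa using hHc f.1 (LinearMap.mem_ker.mp f.2))
  have hφ : ∀ f, (φ f).1 = c f.1 := fun _ => rfl
  let ψ : LinearMap.ker φ →ₗ[ZMod 2] LinearMap.ker (Hᵀ).mulVecLin :=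
    ((a.comp (LinearMap.ker M.mulVecLin).subtype).comp (LinearMap.ker φ).subtype).codRestrict _
      (fun f => by
        have h0 : c f.1.1 = 0 := by
          rw [← hφ, LinearMap.mem_ker.mp f.2]; rfl
        exact LinearMap.mem_ker.mpr (hHa f.1.1 (LinearMap.mem_ker.mp f.1.2) h0))
  have hψ : ∀ f, (ψ f).1 = a f.1.1 := fun _ => rfl
  have hinj : Function.Injective ψ := by
    rw [injective_iff_map_eq_zero]
    intro f hf
    have h0 : c f.1.1 = 0 := by
      rw [← hφ, LinearMap.mem_ker.mp f.2]; rfl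
    have h1 : a f.1.1 = 0 := by rw [← hψ, hf]; rfl
    apply Subtype.ext
    apply Subtype.ext
    ext x
    rw [hker f.1.1 (LinearMap.mem_ker.mp f.1.2) x, h0, h1]
    simp
  have d1 := φ.finrank_range_add_finrank_ker
  have d2 := Submodule.finrank_le (LinearMap.range φ)
  have d3 := LinearMap.finrank_le_finrank_of_injective hinj
  have d4 := finrank_ker_mulVecLin M
  have d5 := finrank_ker_mulVecLin H
  have d6 := finrank_ker_mulVecLin Hᵀ
  rw [Matrix.rank_transpose] at d6
  change Fintype.card {x : V × W // I x.1 x.2} + _ ≤ _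
  omega

/-- The case of even replication number. -/
lemma even_bound {V W : Type*} [Fintype V] [DecidableEq V] [Fintype W]
    (H : Matrix V W (ZMod 2))
    (h0 : ∀ p, ∑ C, H p C * H p C = 0) (h1 : ∀ p q, p ≠ q → ∑ C, H p C * H q C = 1) :
    Fintype.card V ≤ H.rank + 1 := by
  classical
  have d6 := finrank_ker_mulVecLin Hᵀ
  rw [Matrix.rank_transpose] at d6
  have hle : LinearMap.ker (Hᵀ).mulVecLin ≤ Submodule.span (ZMod 2) {fun _ : V => (1 : ZMod 2)} := by
    intro a ha
    rw [LinearMap.mem_ker, Matrix.mulVecLin_apply] at ha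
    rw [Submodule.mem_span_singleton]
    refine ⟨∑ q, a q, ?_⟩
    ext p
    have h : ((H * Hᵀ) *ᵥ a) p = 0 := by
      rw [← Matrix.mulVec_mulVec, ha]; simp
    have h2 : ((H * Hᵀ) *ᵥ a) p = ∑ q, (if q = p then 0 else a q) := by
      refine Finset.sum_congr rfl fun q _ => ?_
      change (H * Hᵀ) p q * a q = _
      rw [Matrix.mul_apply]
      simp only [Matrix.transpose_apply]
      split_ifs with hq
      · subst hq; rw [h0, zero_mul]
      · rw [h1 p q (Ne.symm hq), one_mul]
    have h3 : ∑ q, a q = ∑ q, (if q = p then 0 else a q) + a p := by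
      have : a p = ∑ q, if q = p then a q else 0 := by simp
      rw [this, ← Finset.sum_add_distrib]
      exact Finset.sum_congr rfl fun q _ => by split_ifs <;> simp
    rw [← h2, h, zero_add] at h3
    simp [h3]
  have d7 := Submodule.finrank_mono hle
  have d8 := finrank_span_le_card (R := ZMod 2) ({fun _ : V => (1 : ZMod 2)} : Set (V → ZMod 2))
  simp only [Set.toFinset_singleton, Finset.card_singleton] at d8
  omega

/-- Hillebrandt's bound: the `F_2`-rank of an incidence matrix
`H` of an `S(2,μ,v)` with `2 ≤ μ < v` satisfies
`⌈1/2 + √(1/4 + (v-1)(v-μ)/μ)⌉ ≤ rank H ≤ v`. -/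
theorem stmt12 (V : Type*) [Fintype V] [DecidableEq V] (B : Finset (Finset V))
    (v μ : ℕ) (hv : Fintype.card V = v) (hμ : 2 ≤ μ) (hvμ : μ < v)
    (hsize : ∀ blk ∈ B, blk.card = μ)
    (hpair : ∀ x y : V, x ≠ y → (B.filter (fun blk => x ∈ blk ∧ y ∈ blk)).card = 1)
    (H : Matrix V {blk // blk ∈ B} (ZMod 2))
    (hH : ∀ (x : V) (blk : {blk // blk ∈ B}),
      H x blk = if x ∈ blk.1 then 1 else 0) :
    (⌈(1 : ℝ) / 2 + Real.sqrt (1 / 4 + ((v : ℝ) - 1) * ((v : ℝ) - μ) / μ)⌉ : ℤ)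
        ≤ (H.rank : ℤ) ∧
      H.rank ≤ v := by
  refine ⟨?_, hv ▸ Matrix.rank_le_card_height H⟩
  -- replication number
  have hr : ∀ x : V, (B.filter (fun blk => x ∈ blk)).card * (μ - 1) = v - 1 := by
    intro x
    have h1 : ∑ y ∈ Finset.univ.erase x, (B.filter (fun blk => x ∈ blk ∧ y ∈ blk)).card
        = v - 1 := by
      rw [Finset.sum_congr rfl (fun y hy => hpair x y (Finset.ne_of_mem_erase hy).symm)]
      simp [hv]
    have h2 : ∀ y, (B.filter (fun blk => x ∈ blk ∧ y ∈ blk)).card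
        = ∑ blk ∈ B.filter (fun blk => x ∈ blk), if y ∈ blk then 1 else 0 := by
      intro y
      rw [← Finset.filter_filter, Finset.card_filter]
    rw [← h1]
    simp only [h2]
    rw [Finset.sum_comm, Finset.card_eq_sum_ones, Finset.sum_mul]
    refine Finset.sum_congr rfl fun blk hb => ?_
    rw [Finset.mem_filter] at hb
    rw [← Finset.card_filter, one_mul, ← hsize blk hb.1, ← Finset.card_erase_of_mem hb.2]
    congr 1
    ext y
    simp
  have hne : Nonempty V := Fintype.card_pos_iff.mp (by omega)
  obtain ⟨x0⟩ := hne
  obtain ⟨r, hrr⟩ : ∃ r, r = (B.filter (fun blk => x0 ∈ blk)).card := ⟨_, rfl⟩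
  have hr' : ∀ x : V, (B.filter (fun blk => x ∈ blk)).card = r := by
    intro x
    have := (hr x).trans (hr x0).symm
    rw [hrr]
    exact Nat.eq_of_mul_eq_mul_right (by omega) this
  have hrv : r * (μ - 1) = v - 1 := by rw [hrr]; exact hr x0
  have hrow : ∀ x, ∑ C, H x C = (r : ZMod 2) := by
    intro x
    rw [← hr' x, Finset.card_filter]
    simp only [hH]
    rw [Finset.sum_coe_sort B (fun C => if x ∈ C then (1 : ZMod 2) else 0)]
    simp
  have hprod : ∀ x y, x ≠ y → ∑ C, H x C * H y C = 1 := by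
    intro x y hxy
    have h := hpair x y hxy
    rw [Finset.card_filter] at h
    simp only [hH]
    have := congrArg (Nat.cast : ℕ → ZMod 2) h
    rw [← Finset.sum_coe_sort B] at this
    push_cast at this
    refine Eq.trans ?_ this
    refine Finset.sum_congr rfl fun C _ => ?_
    by_cases h1 : x ∈ C.1 <;> by_cases h2 : y ∈ C.1 <;> simp [h1, h2]
  have hsq : ∀ x, ∑ C, H x C * H x C = (r : ZMod 2) := by
    intro x
    rw [← hrow x]
    refine Finset.sum_congr rfl fun C _ => ?_
    rw [hH]; split_ifs <;> simp
  -- the double counting of flags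
  have hflag : ∑ x : V, (B.filter (fun blk => x ∈ blk)).card = B.card * μ := by
    simp only [Finset.card_filter]
    rw [Finset.sum_comm, Finset.card_eq_sum_ones, Finset.sum_mul]
    refine Finset.sum_congr rfl fun blk hb => ?_
    rw [← Finset.card_filter, one_mul, ← hsize blk hb]
    congr 1
    ext y
    simp
  have hvr : v * r = B.card * μ := by
    rw [← hflag]; simp [hr', hv]
  have hμR : (0 : ℝ) < μ := by exact_mod_cast (by omega : 0 < μ)
  have hvR : (μ : ℝ) + 1 ≤ v := by exact_mod_cast hvμ
  have hμ2 : (2 : ℝ) ≤ μ := by exact_mod_cast hμ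
  have key : 1 ≤ H.rank ∧
      ((v : ℝ) - 1) * ((v : ℝ) - μ) ≤ μ * ((H.rank : ℝ) * (H.rank - 1)) := by
    rcases Nat.even_or_odd r with he | ho
    · have hz : (r : ZMod 2) = 0 := (ZMod.natCast_eq_zero_iff_even).2 he
      have h := even_bound H (fun p => by rw [hsq, hz]) hprod
      rw [hv] at h
      refine ⟨by omega, ?_⟩
      have hR : (v : ℝ) - 1 ≤ H.rank := by
        have : (v : ℝ) ≤ H.rank + 1 := by exact_mod_cast h
        linarith
      have e1 : ((v : ℝ) - 1) * (v - 2) ≤ H.rank * (H.rank - 1) := by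
        apply mul_le_mul <;> linarith
      have e2 : ((v : ℝ) - 1) * (v - μ) ≤ ((v : ℝ) - 1) * (v - 2) := by
        apply mul_le_mul_of_nonneg_left <;> linarith
      have e3 : 0 ≤ ((v : ℝ) - 1) * (v - 2) := by
        apply mul_nonneg <;> linarith
      nlinarith
    · have hz : (r : ZMod 2) = 1 := (ZMod.natCast_eq_one_iff_odd).2 ho
      have h := flag_bound (fun (x : V) (C : {blk // blk ∈ B}) => x ∈ C.1) (by
        intro p q C D hpq h1 h2 h3 h4
        obtain ⟨E, hE⟩ := Finset.card_eq_one.mp (hpair p q hpq)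
        have hC : C.1 ∈ B.filter (fun blk => p ∈ blk ∧ q ∈ blk) := by
          simp [C.2, h1, h2]
        have hD : D.1 ∈ B.filter (fun blk => p ∈ blk ∧ q ∈ blk) := by
          simp [D.2, h3, h4]
        rw [hE, Finset.mem_singleton] at hC hD
        exact Subtype.ext (hC.trans hD.symm)) H hH (fun p => by rw [hrow, hz])
      have hcard : Fintype.card {x : V × {blk // blk ∈ B} // x.1 ∈ x.2.1} = v * r := by
        rw [Fintype.card_subtype, Finset.card_filter, Fintype.sum_prod_type]
        have : ∀ x : V, ∑ C : {blk // blk ∈ B}, (if x ∈ C.1 then 1 else 0) = r := by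
          intro x
          rw [Finset.sum_coe_sort B (fun C => if x ∈ C then 1 else 0), ← Finset.card_filter, hr']
        rw [Finset.sum_congr rfl (fun x _ => this x)]
        simp [hv]
      rw [hcard, hv, Fintype.card_coe] at h
      have hpos : 1 ≤ H.rank := by
        by_contra hcon
        have h00 : H.rank = 0 := by omega
        have hrz : LinearMap.range H.mulVecLin = ⊥ := Submodule.finrank_eq_zero.mp h00
        have hz0 : H = 0 := by
          ext x C
          have hm : H.mulVecLin (Pi.single C 1) ∈ LinearMap.range H.mulVecLin :=
            LinearMap.mem_range_self _ _
          rw [hrz, Submodule.mem_bot] at hm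
          have := congrFun hm x
          simpa using this
        have := hrow x0
        rw [hz, hz0] at this
        simp at this
      refine ⟨hpos, ?_⟩
      have hposR : (1 : ℝ) ≤ H.rank := by exact_mod_cast hpos
      have g1 : (v : ℝ) * r + 2 * H.rank ≤ H.rank ^ 2 + v + B.card := by exact_mod_cast h
      have g2 : (v : ℝ) * r = B.card * μ := by exact_mod_cast hvr
      have g3 : (r : ℝ) * (μ - 1) = v - 1 := by
        have := congrArg (Nat.cast : ℕ → ℝ) hrv
        rw [Nat.cast_mul, Nat.cast_sub (by omega), Nat.cast_sub (by omega)] at this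
        simpa using this
      have g4 : (v : ℝ) * r * (μ - 1) = v * (v - 1) := by rw [mul_assoc, g3]
      have g5 := mul_le_mul_of_nonneg_left g1 hμR.le
      nlinarith
  obtain ⟨k1, k2⟩ := key
  have k1R : (1 : ℝ) ≤ H.rank := by exact_mod_cast k1
  rw [Int.ceil_le]
  push_cast
  have : Real.sqrt (1 / 4 + ((v : ℝ) - 1) * ((v : ℝ) - μ) / μ) ≤ H.rank - 1 / 2 := by
    apply Real.sqrt_le_iff.mpr
    refine ⟨by linarith, ?_⟩
    have : ((v : ℝ) - 1) * ((v : ℝ) - μ) / μ ≤ (H.rank : ℝ) * (H.rank - 1) := by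
      rw [div_le_iff₀ hμR]; linarith
    nlinarith
  linarith
end

section
/- If there exists a homogeneous quantum LDPC code of parameters [[n, k; 1]] obtained from the incidence matrix H of an S(2,μ,v) (so n = v(v−1)/(μ(μ−1)), rank(H·Hᵀ) = 1 over F_2, and k = n − 2·rank(H) + 1), then n − √(1 + 4nμ(μ−1)) ≤ k ≤ n − 2⌈1/2 + √(1/4 + (v−1)(v−μ)/μ)⌉ + 1. -/
open Matrix

/-- Rank factorization. -/
theorem aux_factor {m n : Type*} [Fintype m] [Fintype n] [DecidableEq n]
    (M : Matrix m n (ZMod 2)) :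
    ∃ (A : Matrix m (Fin M.rank) (ZMod 2)) (C : Matrix (Fin M.rank) n (ZMod 2)), M = A * C := by
  let b : Module.Basis (Fin M.rank) (ZMod 2) (LinearMap.range M.mulVecLin) :=
    Module.finBasisOfFinrankEq _ _ rfl
  refine ⟨Matrix.of fun x i => (b i : m → ZMod 2) x,
    Matrix.of fun i j => b.repr ⟨M.mulVecLin (Pi.single j 1), LinearMap.mem_range_self _ _⟩ i, ?_⟩
  ext x j
  have h := congrArg (fun z : LinearMap.range M.mulVecLin => (z : m → ZMod 2) x)
    (b.sum_repr ⟨M.mulVecLin (Pi.single j 1), LinearMap.mem_range_self _ _⟩)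
  simp only [Submodule.coe_sum, Submodule.coe_smul, Finset.sum_apply, Pi.smul_apply,
    smul_eq_mul, Matrix.mulVecLin_apply, Matrix.mulVec_single_one, Matrix.col_apply] at h
  rw [← h, Matrix.mul_apply]
  exact Finset.sum_congr rfl fun i _ => by simp [mul_comm]

/-- Double counting of pairs. -/
theorem aux_count {V : Type*} [Fintype V] [DecidableEq V] (B : Finset (Finset V)) (μ : ℕ)
    (hsize : ∀ blk ∈ B, blk.card = μ)
    (hpair : ∀ x y : V, x ≠ y → (B.filter (fun blk => x ∈ blk ∧ y ∈ blk)).card = 1) :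
    B.card * (μ * μ - μ) = Fintype.card V * Fintype.card V - Fintype.card V := by
  have h := Finset.sum_card_bipartiteAbove_eq_sum_card_bipartiteBelow
    (s := (Finset.univ : Finset V).offDiag) (t := B)
    (fun (p : V × V) (blk : Finset V) => p.1 ∈ blk ∧ p.2 ∈ blk)
  rw [Finset.sum_congr rfl (g := fun _ => 1), Finset.sum_congr (s₁ := B) rfl
    (g := fun _ => μ * μ - μ)] at h
  · simp [Finset.offDiag_card] at h
    exact h.symm
  · intro blk hb
    have : Finset.bipartiteBelow (fun (p : V × V) (blk : Finset V) => p.1 ∈ blk ∧ p.2 ∈ blk)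
        (Finset.univ : Finset V).offDiag blk = blk.offDiag := by
      ext p
      simp [Finset.bipartiteBelow, Finset.mem_offDiag]
      tauto
    rw [this, Finset.offDiag_card, hsize blk hb]
  · intro p hp
    exact hpair p.1 p.2 (Finset.mem_offDiag.1 hp).2.2

/-- The number of flags. -/
theorem aux_flags {V : Type*} [Fintype V] [DecidableEq V] (B : Finset (Finset V)) (μ : ℕ)
    (hsize : ∀ blk ∈ B, blk.card = μ) :
    B.card * μ + Fintype.card {p : V × {blk // blk ∈ B} // p.1 ∉ p.2.1} =
      Fintype.card V * B.card := by
  have h1 := Fintype.card_subtype_compl (fun p : V × {blk // blk ∈ B} => p.1 ∈ p.2.1)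
  have h2 := Fintype.card_subtype_le (fun p : V × {blk // blk ∈ B} => p.1 ∈ p.2.1)
  have h3 : Fintype.card {p : V × {blk // blk ∈ B} // p.1 ∈ p.2.1} = B.card * μ := by
    rw [Fintype.card_subtype, Finset.card_filter, Fintype.sum_prod_type_right]
    have : ∀ b : {blk // blk ∈ B}, (∑ x : V, if x ∈ b.1 then 1 else 0) = μ := by
      intro b
      rw [← hsize b.1 b.2]; simp
    simp [this]
  have h4 : Fintype.card (V × {blk // blk ∈ B}) = Fintype.card V * B.card := by simp
  omega

/-- The main rank bound (r odd). -/
theorem aux_rank {V : Type*} [Fintype V] [DecidableEq V] (B : Finset (Finset V))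
    (μ : ℕ) (hsize : ∀ blk ∈ B, blk.card = μ)
    (hpair : ∀ x y : V, x ≠ y → (B.filter (fun blk => x ∈ blk ∧ y ∈ blk)).card = 1)
    (H : Matrix V {blk // blk ∈ B} (ZMod 2))
    (hH : ∀ (x : V) (blk : {blk // blk ∈ B}), H x blk = if x ∈ blk.1 then 1 else 0)
    (x0 : V) (hodd : ∀ x, ∑ b, H x b = 1) :
    ∃ R', R' + 1 ≤ H.rank ∧
      B.card * μ ≤ (Fintype.card V - 1) + B.card + H.rank * R' := by
  classical
  set G : Matrix V {blk // blk ∈ B} (ZMod 2) := Matrix.of fun y b => H y b + H x0 b with hG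
  have hGr : G.rank + 1 ≤ H.rank := by
    have hlt : LinearMap.ker H.mulVecLin < LinearMap.ker G.mulVecLin := by
      refine lt_of_le_of_ne ?_ ?_
      · intro w hw
        rw [LinearMap.mem_ker, Matrix.mulVecLin_apply] at hw ⊢
        ext y
        have e1 := congrFun hw y
        have e2 := congrFun hw x0
        simp only [Matrix.mulVec, dotProduct, Pi.zero_apply] at e1 e2 ⊢
        simp only [hG, Matrix.of_apply, add_mul, Finset.sum_add_distrib, e1, e2, add_zero]
      · intro heq
        have h1 : (fun _ => 1 : {blk // blk ∈ B} → ZMod 2) ∈ LinearMap.ker G.mulVecLin := by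
          rw [LinearMap.mem_ker, Matrix.mulVecLin_apply]
          ext y
          simp only [Matrix.mulVec, dotProduct, Pi.zero_apply, mul_one]
          simp only [hG, Matrix.of_apply, Finset.sum_add_distrib, hodd]
          exact CharTwo.add_self_eq_zero _
        rw [← heq, LinearMap.mem_ker, Matrix.mulVecLin_apply] at h1
        have := congrFun h1 x0
        simp only [Matrix.mulVec, dotProduct, Pi.zero_apply, mul_one, hodd] at this
        exact one_ne_zero this
    have h1 := Submodule.finrank_lt_finrank_of_lt hlt
    have h2 := H.mulVecLin.finrank_range_add_finrank_ker
    have h3 := G.mulVecLin.finrank_range_add_finrank_ker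
    unfold Matrix.rank
    omega
  refine ⟨G.rank, hGr, ?_⟩
  obtain ⟨A, A', hA⟩ := aux_factor H
  obtain ⟨C, C', hC⟩ := aux_factor G
  let T : Matrix V {blk // blk ∈ B} (ZMod 2) →ₗ[ZMod 2]
      ({p : V × {blk // blk ∈ B} // p.1 ∉ p.2.1} → ZMod 2) × ({y : V // y ≠ x0} → ZMod 2) ×
        ({blk // blk ∈ B} → ZMod 2) × Matrix (Fin H.rank) (Fin G.rank) (ZMod 2) :=
    { toFun := fun Φ => (fun p => Φ p.1.1 p.1.2, fun y => ∑ c, Φ y.1 c, fun c => ∑ y, Φ y c,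
        A' * Φᵀ * C)
      map_add' := by
        intro a b
        refine Prod.ext ?_ (Prod.ext ?_ (Prod.ext ?_ ?_))
        · rfl
        · ext y; simp [Finset.sum_add_distrib]
        · ext y; simp [Finset.sum_add_distrib]
        · simp [Matrix.mul_add, Matrix.add_mul]
      map_smul' := by
        intro t b
        refine Prod.ext ?_ (Prod.ext ?_ (Prod.ext ?_ ?_))
        · rfl
        · ext y; simp [Finset.mul_sum]
        · ext y; simp [Finset.mul_sum]
        · simp }
  have hT : Function.Injective T := by
    rw [← LinearMap.ker_eq_bot, LinearMap.ker_eq_bot']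
    intro Φ hΦ
    have k1 : ∀ x b, x ∉ b.1 → Φ x b = 0 := fun x b h =>
      congrFun (congrArg Prod.fst hΦ) ⟨(x, b), h⟩
    have k2 : ∀ y, y ≠ x0 → ∑ c, Φ y c = 0 := fun y h =>
      congrFun (congrArg (fun z => z.2.1) hΦ) ⟨y, h⟩
    have k3 : ∀ c, ∑ y, Φ y c = 0 := fun c =>
      congrFun (congrArg (fun z => z.2.2.1) hΦ) c
    have k4 : A' * Φᵀ * C = 0 := congrArg (fun z => z.2.2.2) hΦ
    have k2' : ∀ y, ∑ c, Φ y c = 0 := by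
      intro y
      by_cases hy : y = x0
      · have : ∑ y, ∑ c, Φ y c = 0 := by
          refine Eq.trans (Finset.sum_comm (f := fun y c => Φ y c)) ?_
          exact Finset.sum_eq_zero fun c _ => k3 c
        rw [Finset.sum_eq_single y] at this
        · exact this
        · intro z _ hz; exact k2 z (hy ▸ hz)
        · simp
      · exact k2 y hy
    have k5 : H * Φᵀ * G = 0 := by
      rw [hA, hC]
      calc A * A' * Φᵀ * (C * C') = A * (A' * Φᵀ * C) * C' := by simp only [Matrix.mul_assoc]
        _ = 0 := by rw [k4]; simp
    ext x b
    by_cases hx : x ∈ b.1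
    swap
    · exact k1 x b hx
    have k6 := congrFun (congrFun k5 x) b
    simp only [Matrix.mul_apply, Matrix.transpose_apply, Matrix.zero_apply, Finset.sum_mul] at k6
    -- termwise identity
    have key : ∀ y c, H x c * Φ y c * G y b =
        (if y = x then Φ y c else 0) + (if c = b then Φ y c else 0) +
        (if y = x then (if c = b then Φ y c else 0) else 0) + H x0 b * H x c * Φ y c := by
      intro y c
      have hGy : G y b = H y b + H x0 b := rfl
      rw [hGy]
      have : H x c * Φ y c * H y b = (if y = x then Φ y c else 0) + (if c = b then Φ y c else 0) +
        (if y = x then (if c = b then Φ y c else 0) else 0) := by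
        by_cases hyc : y ∈ c.1
        swap
        · simp [k1 y c hyc]
        by_cases hyx : y = x
        · subst hyx
          have two : Φ y c + Φ y c = 0 := CharTwo.add_self_eq_zero _
          by_cases hcb : c = b
          · simp [hH, hx, hyc, hcb]
            rw [hcb] at two
            rw [two]
          · simp [hH, hx, hyc, hcb]
        · by_cases hcb : c = b
          · subst hcb
            simp [hH, hx, hyc, hyx]
          · simp only [hyx, hcb, if_false, add_zero]
            by_cases h1 : x ∈ c.1
            · by_cases h2 : y ∈ b.1
              · exfalso
                apply hcb
                have := Finset.card_le_one.1 (hpair x y (Ne.symm hyx)).le c.1 (by simp [c.2, h1, hyc])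
                  b.1 (by simp [b.2, hx, h2])
                exact Subtype.ext this
              · simp [hH, h2]
            · simp [hH, h1]
      rw [mul_add, this]; ring
    simp only [key, Finset.sum_add_distrib] at k6
    have s1 : ∑ y, ∑ c, (if y = x then Φ y c else 0) = 0 := by
      rw [Finset.sum_eq_single x]
      · simpa using k2' x
      · simp +contextual
      · simp
    have s2 : ∑ y, ∑ c, (if c = b then Φ y c else 0) = 0 := by simp [k3]
    have s3 : ∑ y, ∑ c, (if y = x then (if c = b then Φ y c else 0) else 0) = Φ x b := by
      rw [Finset.sum_eq_single x] <;> simp +contextual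
    have s4 : ∑ y, ∑ c, H x0 b * H x c * Φ y c = 0 := by
      rw [Finset.sum_comm]
      simp [← Finset.mul_sum, k3]
    rw [s1, s2, s3, s4] at k6
    simpa using k6
  have hfin := LinearMap.finrank_le_finrank_of_injective hT
  have hf := aux_flags B μ hsize
  have hc : Fintype.card {y : V // y ≠ x0} = Fintype.card V - 1 := by
    simp
  simp only [Module.finrank_prod, Module.finrank_fintype_fun_eq_card, Module.finrank_matrix,
    Module.finrank_self, Fintype.card_fin, hc, mul_one, Fintype.card_coe] at hfin
  omega

/-- Rank one of `H Hᵀ` forces every point to lie on an odd number of blocks. -/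
theorem aux_odd {V : Type*} [Fintype V] [DecidableEq V] (B : Finset (Finset V))
    (hcard : 3 ≤ Fintype.card V)
    (hpair : ∀ x y : V, x ≠ y → (B.filter (fun blk => x ∈ blk ∧ y ∈ blk)).card = 1)
    (H : Matrix V {blk // blk ∈ B} (ZMod 2))
    (hH : ∀ (x : V) (blk : {blk // blk ∈ B}), H x blk = if x ∈ blk.1 then 1 else 0)
    (hrank1 : (H * Hᵀ).rank = 1) (x : V) : ∑ b, H x b = 1 := by
  have hoff : ∀ x y, x ≠ y → (H * Hᵀ) x y = 1 := by
    intro x y hxy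
    have e : (H * Hᵀ) x y = ∑ b : {blk // blk ∈ B}, if x ∈ b.1 ∧ y ∈ b.1 then (1 : ZMod 2) else 0 := by
      rw [Matrix.mul_apply]
      refine Finset.sum_congr rfl fun b _ => ?_
      simp only [Matrix.transpose_apply, hH]
      split_ifs <;> simp_all
    rw [e, Finset.sum_coe_sort B (fun b => if x ∈ b ∧ y ∈ b then (1 : ZMod 2) else 0),
      Finset.sum_boole, hpair x y hxy, Nat.cast_one]
  have hdiag : (H * Hᵀ) x x = ∑ b, H x b := by
    rw [Matrix.mul_apply]
    refine Finset.sum_congr rfl fun b _ => ?_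
    simp only [Matrix.transpose_apply, hH]
    split_ifs <;> simp
  rw [← hdiag]
  by_contra hne
  have h0 : (H * Hᵀ) x x = 0 := by
    generalize (H * Hᵀ) x x = t at hne
    revert t; decide
  obtain ⟨y, hy⟩ : ∃ y, y ∉ ({x} : Finset V) := by
    by_contra hcon
    push Not at hcon
    have := Finset.card_le_card (fun y _ => hcon y : (Finset.univ : Finset V) ⊆ {x})
    simp at this; omega
  obtain ⟨z, hz⟩ : ∃ z, z ∉ ({x, y} : Finset V) := by
    by_contra hcon
    push Not at hcon
    have := Finset.card_le_card (fun y _ => hcon y : (Finset.univ : Finset V) ⊆ {x, y})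
    have h2 := Finset.card_le_two (a := x) (b := y)
    rw [Finset.card_univ] at this; omega
  simp only [Finset.mem_singleton, Finset.mem_insert, not_or] at hy hz
  have hr := Matrix.rank_submatrix_le (H * Hᵀ) ![x, y] ![x, z]
  rw [Matrix.rank_of_det_ne_zero, hrank1] at hr
  · simp at hr
  · rw [Matrix.det_fin_two]
    simp only [Matrix.submatrix_apply, Matrix.cons_val_zero, Matrix.cons_val_one, h0,
      hoff x z (Ne.symm hz.1), hoff y x hy]
    simp

/-- Bounds on the dimension `k = n - 2·rank H + 1` of a
homogeneous entanglement-assisted quantum LDPC code of parameters `[[n,k;1]]`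
obtained from the incidence matrix `H` of an `S(2,μ,v)` with
`n = v(v-1)/(μ(μ-1))` blocks and `rank (H·Hᵀ) = 1`:
`n - √(1 + 4nμ(μ-1)) ≤ k ≤ n - 2⌈1/2 + √(1/4 + (v-1)(v-μ)/μ)⌉ + 1`. -/
theorem stmt13 (V : Type*) [Fintype V] [DecidableEq V] (B : Finset (Finset V))
    (v μ n : ℕ) (hv : Fintype.card V = v) (hμ : 2 ≤ μ) (hvμ : μ < v)
    (hsize : ∀ blk ∈ B, blk.card = μ)
    (hpair : ∀ x y : V, x ≠ y → (B.filter (fun blk => x ∈ blk ∧ y ∈ blk)).card = 1)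
    (hn : B.card = n)
    (H : Matrix V {blk // blk ∈ B} (ZMod 2))
    (hH : ∀ (x : V) (blk : {blk // blk ∈ B}),
      H x blk = if x ∈ blk.1 then 1 else 0)
    (hrank1 : (H * Hᵀ).rank = 1)
    (k : ℤ) (hk : k = (n : ℤ) - 2 * (H.rank : ℤ) + 1) :
    (n : ℝ) - Real.sqrt (1 + 4 * n * μ * (μ - 1)) ≤ (k : ℝ) ∧
      (k : ℝ) ≤ (n : ℝ)
        - 2 * (⌈(1 : ℝ) / 2 + Real.sqrt (1 / 4 + ((v : ℝ) - 1) * ((v : ℝ) - μ) / μ)⌉ : ℤ)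
        + 1 := by
  have hcnt := aux_count B μ hsize hpair
  rw [hn, hv] at hcnt
  have hcntR : (n : ℝ) * μ * (μ - 1) = v * (v - 1) := by
    have h1 : μ ≤ μ * μ := Nat.le_mul_self μ
    have h2 : v ≤ v * v := Nat.le_mul_self v
    have := congrArg (Nat.cast : ℕ → ℝ) hcnt
    push_cast [Nat.cast_sub h1, Nat.cast_sub h2] at this
    linarith
  have hμR : (2 : ℝ) ≤ μ := by exact_mod_cast hμ
  have hvR : (μ : ℝ) + 1 ≤ v := by exact_mod_cast hvμ
  have hkR : (k : ℝ) = n - 2 * (H.rank : ℝ) + 1 := by rw [hk]; push_cast; ring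
  constructor
  · have hs : Real.sqrt (1 + 4 * n * μ * (μ - 1)) = 2 * v - 1 := by
      rw [show (1 + 4 * n * μ * (μ - 1) : ℝ) = (2 * v - 1) ^ 2 by linarith]
      exact Real.sqrt_sq (by linarith)
    have hle : (H.rank : ℝ) ≤ v := by
      rw [← hv]; exact_mod_cast H.rank_le_card_height
    rw [hs, hkR]; linarith
  · have hodd := aux_odd B (by omega) hpair H hH hrank1
    obtain ⟨x0⟩ : Nonempty V := Fintype.card_pos_iff.1 (by omega)
    obtain ⟨R', hR', hb⟩ := aux_rank B μ hsize hpair H hH x0 hodd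
    rw [hn, hv] at hb
    have hbR : (n : ℝ) * μ ≤ (v - 1) + n + H.rank * R' := by
      have : ((n * μ : ℕ) : ℝ) ≤ ((v - 1 + n + H.rank * R' : ℕ) : ℝ) := by exact_mod_cast hb
      push_cast [Nat.cast_sub (show 1 ≤ v by omega)] at this
      exact this
    have hR'R : (R' : ℝ) + 1 ≤ H.rank := by exact_mod_cast hR'
    have hR0 : (0 : ℝ) ≤ R' := by positivity
    have hval : ((v : ℝ) - 1) * ((v : ℝ) - μ) / μ = n * μ - (v - 1) - n := by
      rw [div_eq_iff (by linarith)]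
      linarith
    have hceil : ⌈(1 : ℝ) / 2 + Real.sqrt (1 / 4 + ((v : ℝ) - 1) * ((v : ℝ) - μ) / μ)⌉
        ≤ (H.rank : ℤ) := by
      rw [Int.ceil_le]
      have : Real.sqrt (1 / 4 + ((v : ℝ) - 1) * ((v : ℝ) - μ) / μ) ≤ H.rank - 1 / 2 := by
        apply Real.sqrt_le_iff.2
        constructor
        · linarith
        · rw [hval]
          nlinarith
      push_cast
      linarith
    have hceilR : ((⌈(1 : ℝ) / 2 + Real.sqrt (1 / 4 + ((v : ℝ) - 1) * ((v : ℝ) - μ) / μ)⌉ : ℤ) : ℝ)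
        ≤ (H.rank : ℝ) := by exact_mod_cast hceil
    rw [hkR]; linarith
end
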